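/- Let K, A, B, E be finite sets and let V : A → B and W : A → E be classical channels (stochastic matrices). Assume max over probability distributions P on A of [I(P,V) − I(P,W)] > 0, where I(P,V) is the Shannon mutual information (in bits) between an input distributed according to P and the output of V. Then for every α, β ∈ (0,1) and every sufficiently large n ∈ ℕ there exist a channel (random coder) F_A from K to Aⁿ and a function (decoder) f_B : Bⁿ → K such that for every function (adversary decoder) f_E : Eⁿ → K the following hold, where K_A is uniformly distributed on K, K_B = f_B(Vⁿ(F_A(K_A))) and K_E = f_E(Wⁿ(F_A(K_A))) with Vⁿ, Wⁿ the n-fold memoryless extensions of V, W: (1) Pr[K_A = K_B] ≥ α, and (2) I(K_A; K_E) ≤ 1 − β. -/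

import Mathlib

open scoped BigOperators ComplexOrder

noncomputable section

namespace QKD

/-- A probability distribution on a finite type. -/
def IsProbDist {α : Type*} [Fintype α] (P : α → ℝ) : Prop :=
  (∀ a, 0 ≤ P a) ∧ ∑ a, P a = 1

/-- A classical channel (stochastic matrix) from `α` to `β`. -/
def IsChannel {α β : Type*} [Fintype α] [Fintype β] (V : α → β → ℝ) : Prop :=
  (∀ a b, 0 ≤ V a b) ∧ ∀ a, ∑ b, V a b = 1

/-- Shannon entropy, in bits. -/
def entropy {α : Type*} [Fintype α] (P : α → ℝ) : ℝ :=
  (∑ a, Real.negMulLog (P a)) / Real.log 2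

/-- Shannon mutual information (in bits) of a joint distribution on `α × β`. -/
def miJoint {α β : Type*} [Fintype α] [Fintype β] (J : α → β → ℝ) : ℝ :=
  entropy (fun a => ∑ b, J a b) + entropy (fun b => ∑ a, J a b)
    - entropy (fun p : α × β => J p.1 p.2)

/-- `I(P,V)`: mutual information between input distributed by `P` and output of channel `V`. -/
def chanMI {α β : Type*} [Fintype α] [Fintype β] (P : α → ℝ) (V : α → β → ℝ) : ℝ :=
  miJoint (fun a b => P a * V a b)

/-- The n-fold memoryless extension of a channel. -/
def nfold {α β : Type*} (n : ℕ) (V : α → β → ℝ) : (Fin n → α) → (Fin n → β) → ℝ :=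
  fun a b => ∏ i, V (a i) (b i)

/-- Joint distribution of Alice's key `K_A` (uniform on `K`) and the key obtained
by sending `K_A` through the random coder `F`, the channel `V`, and the decoder `f`. -/
def keyJoint {K A B : Type*} [Fintype K] [Fintype A] [Fintype B] [DecidableEq K]
    (F : K → A → ℝ) (V : A → B → ℝ) (f : B → K) : K → K → ℝ :=
  fun k k' => (Fintype.card K : ℝ)⁻¹ * ∑ a, F k a * ∑ b, if f b = k' then V a b else 0

/-- A density matrix: positive semidefinite with trace 1. -/
def IsDensity {ι : Type*} [Fintype ι] (ρ : Matrix ι ι ℂ) : Prop :=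
  ρ.PosSemidef ∧ ρ.trace = 1

/-- A POVM with outcomes in `B`: positive semidefinite operators summing to the identity. -/
def IsPOVM {ι B : Type*} [Fintype ι] [DecidableEq ι] [Fintype B]
    (M : B → Matrix ι ι ℂ) : Prop :=
  (∀ b, (M b).PosSemidef) ∧ ∑ b, M b = 1

/-- Von Neumann entropy (in bits) of a Hermitian matrix, via its eigenvalues. -/
def vnEntropy {ι : Type*} [Fintype ι] [DecidableEq ι] (ρ : Matrix ι ι ℂ) : ℝ :=
  if h : ρ.IsHermitian then (∑ i, Real.negMulLog (h.eigenvalues i)) / Real.log 2 else 0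

/-- The Holevo quantity χ(P, ξ) of the ensemble `{P(a), ξ(a)}`. -/
def holevo {A ι : Type*} [Fintype A] [Fintype ι] [DecidableEq ι]
    (P : A → ℝ) (ξ : A → Matrix ι ι ℂ) : ℝ :=
  vnEntropy (∑ a, (P a : ℂ) • ξ a) - ∑ a, P a * vnEntropy (ξ a)

/-- Probability of outcome `b` when measuring the state `ρ` with the POVM `M`. -/
def measProb {ι B : Type*} [Fintype ι] (M : B → Matrix ι ι ℂ)
    (ρ : Matrix ι ι ℂ) (b : B) : ℝ :=
  ((M b * ρ).trace).re

/-- Mutual information (in bits) between an input `a ~ P` and the outcome of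
measuring `ξ(a)` with the POVM `M`. -/
def measMI {A ι B : Type*} [Fintype A] [Fintype ι] [Fintype B]
    (P : A → ℝ) (ξ : A → Matrix ι ι ℂ) (M : B → Matrix ι ι ℂ) : ℝ :=
  miJoint (fun a b => P a * measProb M (ξ a) b)

/-- The tensor-power state `ξ(a₁) ⊗ ⋯ ⊗ ξ(a_n)`. -/
def tensPow {A ι : Type*} {n : ℕ} (ξ : A → Matrix ι ι ℂ) (a : Fin n → A) :
    Matrix (Fin n → ι) (Fin n → ι) ℂ :=
  Matrix.of fun v w => ∏ i, ξ (a i) (v i) (w i)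

/-- The set of Holevo quantities over all input distributions. -/
def holevoSet {A ι : Type*} [Fintype A] [Fintype ι] [DecidableEq ι]
    (ξ : A → Matrix ι ι ℂ) : Set ℝ :=
  { x | ∃ P : A → ℝ, IsProbDist P ∧ x = holevo P ξ }

/-- The set of accessible informations: mutual informations achievable with some
input distribution and some POVM (with an arbitrary finite outcome set). -/
def accInfoSet {A ι : Type*} [Fintype A] [Fintype ι] [DecidableEq ι]
    (ξ : A → Matrix ι ι ℂ) : Set ℝ :=
  { x | ∃ (P : A → ℝ) (m : ℕ) (M : Fin m → Matrix ι ι ℂ),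
      IsProbDist P ∧ IsPOVM M ∧ x = measMI P ξ M }



/-! ### Random codebooks -/

lemma sum_pi_prod {ι X : Type*} [Fintype ι] [DecidableEq ι] [Fintype X] (h : ι → X → ℝ) :
    ∑ c : ι → X, ∏ i, h i (c i) = ∏ i, ∑ x, h i x := by
  rw [Finset.prod_univ_sum, Fintype.piFinset_univ]

/-- Expectation of a function of the random codebook `c` with iid entries of law `P`. -/
def ex {ι X : Type*} [Fintype ι] [DecidableEq ι] [Fintype X] (P : X → ℝ) (G : (ι → X) → ℝ) : ℝ :=
  ∑ c : ι → X, (∏ i, P (c i)) * G c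

section
variable {ι X : Type*} [Fintype ι] [DecidableEq ι] [Fintype X] {P : X → ℝ}

lemma ex_two (hP : IsProbDist P) (f g : X → ℝ) {i j : ι} (hij : i ≠ j) :
    ex P (fun c : ι → X => f (c i) * g (c j)) = (∑ x, P x * f x) * ∑ x, P x * g x := by
  have h1 : ∀ c : ι → X, (∏ i, P (c i)) * (f (c i) * g (c j)) =
      ∏ m, P (c m) * ((if m = i then f (c m) else 1) * (if m = j then g (c m) else 1)) := by
    intro c
    rw [Finset.prod_mul_distrib, Finset.prod_mul_distrib]
    simp
  unfold ex
  simp_rw [h1]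
  rw [sum_pi_prod (fun m x => P x * ((if m = i then f x else 1) * (if m = j then g x else 1)))]
  have h2 : ∀ m : ι, ∑ x, P x * ((if m = i then f x else 1) * (if m = j then g x else 1)) =
      (if m = i then ∑ x, P x * f x else 1) * (if m = j then ∑ x, P x * g x else 1) := by
    intro m
    by_cases hi : m = i
    · have hj : m ≠ j := fun h => hij (hi.symm.trans h)
      simp [hi, hij]
    · by_cases hj : m = j
      · simp [hj, hij.symm]
      · simp [hi, hj, hP.2]
  simp_rw [h2]
  rw [Finset.prod_mul_distrib]
  simp

lemma ex_one (hP : IsProbDist P) (f : X → ℝ) (i : ι) :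
    ex P (fun c : ι → X => f (c i)) = ∑ x, P x * f x := by
  have h1 : ∀ c : ι → X, (∏ i, P (c i)) * (f (c i)) =
      ∏ m, P (c m) * ((if m = i then f (c m) else 1)) := by
    intro c
    rw [Finset.prod_mul_distrib]
    simp
  unfold ex
  simp_rw [h1]
  rw [sum_pi_prod (fun m x => P x * (if m = i then f x else 1))]
  have h2 : ∀ m : ι, ∑ x, P x * (if m = i then f x else 1) =
      (if m = i then ∑ x, P x * f x else 1) := by
    intro m
    by_cases hi : m = i
    · simp [hi]
    · simp [hi, hP.2]
  simp_rw [h2]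
  simp

lemma wt_nonneg (hP : IsProbDist P) (c : ι → X) : 0 ≤ ∏ i, P (c i) :=
  Finset.prod_nonneg fun _ _ => hP.1 _

lemma wt_sum (hP : IsProbDist P) : ∑ c : ι → X, ∏ i, P (c i) = 1 := by
  rw [sum_pi_prod (fun _ x => P x)]
  simp [hP.2]

lemma ex_const (hP : IsProbDist P) (r : ℝ) : ex P (fun _ : ι → X => r) = r := by
  unfold ex
  rw [← Finset.sum_mul, wt_sum hP, one_mul]

lemma ex_mono (hP : IsProbDist P) {G H : (ι → X) → ℝ} (h : ∀ c, G c ≤ H c) :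
    ex P G ≤ ex P H :=
  Finset.sum_le_sum fun c _ => mul_le_mul_of_nonneg_left (h c) (wt_nonneg hP c)

lemma ex_add (G H : (ι → X) → ℝ) : ex P (fun c => G c + H c) = ex P G + ex P H := by
  unfold ex
  rw [← Finset.sum_add_distrib]
  exact Finset.sum_congr rfl fun c _ => mul_add _ _ _

lemma ex_sum {τ : Type*} (s : Finset τ) (G : τ → (ι → X) → ℝ) :
    ex P (fun c => ∑ t ∈ s, G t c) = ∑ t ∈ s, ex P (G t) := by
  unfold ex
  rw [Finset.sum_comm]
  exact Finset.sum_congr rfl fun c _ => Finset.mul_sum _ _ _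

lemma ex_smul (r : ℝ) (G : (ι → X) → ℝ) : ex P (fun c => r * G c) = r * ex P G := by
  unfold ex
  rw [Finset.mul_sum]
  exact Finset.sum_congr rfl fun c _ => by ring

lemma ex_exists (hP : IsProbDist P) {G : (ι → X) → ℝ} {r : ℝ} (h : ex P G ≤ r) :
    ∃ c, G c ≤ r := by
  by_contra! hc
  have h2 : ex P G - r = ∑ c : ι → X, (∏ i, P (c i)) * (G c - r) := by
    simp_rw [mul_sub]
    rw [Finset.sum_sub_distrib, ← Finset.sum_mul, wt_sum hP, one_mul]
    rfl
  have h3 : ∀ c ∈ Finset.univ, 0 ≤ (∏ i, P (c i)) * (G c - r) := fun c _ =>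
    mul_nonneg (wt_nonneg hP c) (sub_nonneg.2 (hc c).le)
  have h4 : ∑ c : ι → X, (∏ i, P (c i)) * (G c - r) = 0 :=
    le_antisymm (by rw [← h2]; linarith) (Finset.sum_nonneg h3)
  have h5 := (Finset.sum_eq_zero_iff_of_nonneg h3).1 h4
  have h6 : ∑ c : ι → X, ∏ i, P (c i) = 0 := by
    refine Finset.sum_eq_zero fun c hcu => ?_
    rcases mul_eq_zero.1 (h5 c hcu) with h | h
    · exact h
    · linarith [hc c]
  rw [wt_sum hP] at h6
  exact one_ne_zero h6

lemma ex_abs_le (hP : IsProbDist P) (G : (ι → X) → ℝ) :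
    ex P (fun c => |G c|) ≤ Real.sqrt (ex P (fun c => G c ^ 2)) := by
  apply Real.le_sqrt_of_sq_le
  have := Finset.sum_sq_le_sum_mul_sum_of_sq_le_mul (R := ℝ) (Finset.univ : Finset (ι → X))
    (f := fun c => ∏ i, P (c i)) (g := fun c => (∏ i, P (c i)) * G c ^ 2)
    (r := fun c => (∏ i, P (c i)) * |G c|)
    (fun c _ => wt_nonneg hP c) (fun c _ => mul_nonneg (wt_nonneg hP c) (sq_nonneg _))
    (fun c _ => le_of_eq (by rw [mul_pow, sq_abs]; ring))
  rw [wt_sum hP, one_mul] at this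
  exact this

/-- Variance of the empirical mean. -/
lemma ex_var (hP : IsProbDist P) {L : ℕ} (hL : 0 < L) (e : Fin L → ι)
    (he : Function.Injective e) (f : X → ℝ) :
    ex P (fun c : ι → X => ((L : ℝ)⁻¹ * ∑ l, f (c (e l)) - ∑ x, P x * f x) ^ 2)
      ≤ (L : ℝ)⁻¹ * ∑ x, P x * f x ^ 2 := by
  set μ := ∑ x, P x * f x with hμ
  have hL' : (L : ℝ) ≠ 0 := by positivity
  have h1 : ∀ c : ι → X, ((L : ℝ)⁻¹ * ∑ l, f (c (e l)) - μ) ^ 2 =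
      ((L : ℝ)⁻¹) ^ 2 * ∑ l, ∑ m, (f (c (e l)) - μ) * (f (c (e m)) - μ) := by
    intro c
    rw [← Finset.sum_mul_sum, ← sq, ← mul_pow, Finset.sum_sub_distrib, mul_sub]
    simp [hL']
  have h0 : ∑ x, P x * (f x - μ) = 0 := by
    simp_rw [mul_sub]
    rw [Finset.sum_sub_distrib, ← Finset.sum_mul, hP.2, one_mul, ← hμ, sub_self]
  have h2 : ∑ x, P x * (f x - μ) ^ 2 ≤ ∑ x, P x * f x ^ 2 := by
    have : ∑ x, P x * (f x - μ) ^ 2 = ∑ x, P x * f x ^ 2 - μ ^ 2 := by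
      have : ∀ x, P x * (f x - μ) ^ 2 = P x * f x ^ 2 - 2 * μ * (P x * f x) + μ ^ 2 * P x := by
        intro x; ring
      simp_rw [this]
      rw [Finset.sum_add_distrib, Finset.sum_sub_distrib, ← Finset.mul_sum, ← Finset.mul_sum,
        hP.2, ← hμ]
      ring
    rw [this]
    linarith [sq_nonneg μ]
  have h3 : ∀ l m : Fin L, ex P (fun c : ι → X => (f (c (e l)) - μ) * (f (c (e m)) - μ)) =
      if l = m then ∑ x, P x * (f x - μ) ^ 2 else 0 := by
    intro l m
    by_cases h : l = m
    · subst h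
      rw [if_pos rfl, ← ex_one hP (fun x => (f x - μ) ^ 2) (e l)]
      congr 1; funext c; ring
    · rw [if_neg h, ex_two hP (fun x => f x - μ) (fun x => f x - μ) (fun h' => h (he h')), h0,
        zero_mul]
  simp_rw [h1]
  rw [ex_smul, ex_sum]
  simp_rw [ex_sum, h3]
  simp only [Finset.sum_ite_eq, Finset.mem_univ, if_true, Finset.sum_const, Finset.card_univ,
    Fintype.card_fin, nsmul_eq_mul]
  have : ((L : ℝ)⁻¹) ^ 2 * (L * ∑ x, P x * (f x - μ) ^ 2)
      = (L : ℝ)⁻¹ * ∑ x, P x * (f x - μ) ^ 2 := by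
    field_simp
  rw [this]
  exact mul_le_mul_of_nonneg_left h2 (by positivity)

open Classical in
/-- Soft covering. -/
lemma soft_covering {Z : Type*} [Fintype Z] (hP : IsProbDist P) {W : X → Z → ℝ}
    (hW : IsChannel W) {L : ℕ} (hL : 0 < L) (e : Fin L → ι) (he : Function.Injective e)
    {γ : ℝ} (hγ : 0 < γ) {q : Z → ℝ} (hq : ∀ z, q z = ∑ x, P x * W x z) :
    ex P (fun c : ι → X => ∑ z, |(L : ℝ)⁻¹ * ∑ l, W (c (e l)) z - q z|)
      ≤ 2 * (∑ x, ∑ z, if γ * q z < W x z then P x * W x z else 0) + Real.sqrt (γ / L) := by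
  have hL' : (L : ℝ) ≠ 0 := by positivity
  have hq0 : ∀ z, 0 ≤ q z := fun z => by
    rw [hq]; exact Finset.sum_nonneg fun x _ => mul_nonneg (hP.1 x) (hW.1 x z)
  have hq1 : ∑ z, q z = 1 := by
    simp_rw [hq]
    rw [Finset.sum_comm]
    simp_rw [← Finset.mul_sum, hW.2, mul_one]
    exact hP.2
  set W2 : X → Z → ℝ := fun x z => if γ * q z < W x z then W x z else 0 with hW2
  set W1 : X → Z → ℝ := fun x z => if γ * q z < W x z then 0 else W x z with hW1
  have hsum : ∀ x z, W x z = W1 x z + W2 x z := by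
    intro x z; simp only [hW1, hW2]; split_ifs <;> simp
  have hW20 : ∀ x z, 0 ≤ W2 x z := by
    intro x z; simp only [hW2]; split_ifs; exacts [hW.1 x z, le_rfl]
  have hW10 : ∀ x z, 0 ≤ W1 x z := by
    intro x z; simp only [hW1]; split_ifs; exacts [le_rfl, hW.1 x z]
  have hW1γ : ∀ x z, W1 x z ≤ γ * q z := by
    intro x z; simp only [hW1]; split_ifs with h
    · exact mul_nonneg hγ.le (hq0 z)
    · exact not_lt.1 h
  have hW1W : ∀ x z, W1 x z ≤ W x z := by
    intro x z; linarith [hsum x z, hW20 x z]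
  have key : ∀ z, ex P (fun c : ι → X => |(L : ℝ)⁻¹ * ∑ l, W (c (e l)) z - q z|)
      ≤ q z * Real.sqrt (γ / L) + 2 * ∑ x, P x * W2 x z := by
    intro z
    set μ1 := ∑ x, P x * W1 x z with hμ1
    set μ2 := ∑ x, P x * W2 x z with hμ2
    have hμ20 : 0 ≤ μ2 := Finset.sum_nonneg fun x _ => mul_nonneg (hP.1 x) (hW20 x z)
    have hqq : q z = μ1 + μ2 := by
      rw [hq, hμ1, hμ2, ← Finset.sum_add_distrib]
      exact Finset.sum_congr rfl fun x _ => by rw [hsum]; ring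
    have hb : ∀ c : ι → X, |(L : ℝ)⁻¹ * ∑ l, W (c (e l)) z - q z| ≤
        |(L : ℝ)⁻¹ * ∑ l, W1 (c (e l)) z - μ1| + ((L : ℝ)⁻¹ * ∑ l, W2 (c (e l)) z + μ2) := by
      intro c
      have h1 : (L : ℝ)⁻¹ * ∑ l, W (c (e l)) z - q z =
        ((L : ℝ)⁻¹ * ∑ l, W1 (c (e l)) z - μ1) + ((L : ℝ)⁻¹ * ∑ l, W2 (c (e l)) z - μ2) := by
        simp_rw [hsum]
        rw [Finset.sum_add_distrib, hqq]; ring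
      have h2 : 0 ≤ (L : ℝ)⁻¹ * ∑ l, W2 (c (e l)) z :=
        mul_nonneg (by positivity) (Finset.sum_nonneg fun l _ => hW20 _ _)
      rw [h1]
      refine (abs_add_le _ _).trans (add_le_add le_rfl ?_)
      rw [abs_le]; constructor <;> linarith
    refine (ex_mono hP hb).trans ?_
    rw [ex_add, ex_add, ex_const hP, ex_smul, ex_sum]
    simp_rw [ex_one hP (fun x => W2 x z)]
    rw [← hμ2]
    simp only [Finset.sum_const, Finset.card_univ, Fintype.card_fin, nsmul_eq_mul]
    rw [inv_mul_cancel_left₀ hL']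
    have h3 : ex P (fun c : ι → X => |(L : ℝ)⁻¹ * ∑ l, W1 (c (e l)) z - μ1|)
        ≤ q z * Real.sqrt (γ / L) := by
      refine (ex_abs_le hP _).trans ?_
      have : q z * Real.sqrt (γ / L) = Real.sqrt (q z ^ 2 * (γ / L)) := by
        rw [Real.sqrt_mul (sq_nonneg _), Real.sqrt_sq (hq0 z)]
      rw [this]
      apply Real.sqrt_le_sqrt
      refine (ex_var hP hL e he (fun x => W1 x z)).trans ?_
      have : ∑ x, P x * W1 x z ^ 2 ≤ γ * q z * q z := by
        calc ∑ x, P x * W1 x z ^ 2 ≤ ∑ x, γ * q z * (P x * W x z) := by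
              refine Finset.sum_le_sum fun x _ => ?_
              have := mul_le_mul (hW1γ x z) (hW1W x z) (hW10 x z) (mul_nonneg hγ.le (hq0 z))
              calc P x * W1 x z ^ 2 = P x * (W1 x z * W1 x z) := by ring
                _ ≤ P x * (γ * q z * W x z) := mul_le_mul_of_nonneg_left this (hP.1 x)
                _ = _ := by ring
          _ = _ := by rw [← Finset.mul_sum, ← hq]
      calc (L : ℝ)⁻¹ * ∑ x, P x * W1 x z ^ 2 ≤ (L : ℝ)⁻¹ * (γ * q z * q z) :=
            mul_le_mul_of_nonneg_left this (by positivity)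
        _ = _ := by rw [div_eq_mul_inv]; ring
    linarith
  rw [ex_sum]
  refine (Finset.sum_le_sum fun z _ => key z).trans ?_
  rw [Finset.sum_add_distrib, ← Finset.sum_mul, hq1, one_mul, ← Finset.mul_sum, Finset.sum_comm]
  have : ∀ x z, P x * W2 x z = if γ * q z < W x z then P x * W x z else 0 := by
    intro x z; simp only [hW2]; split_ifs <;> simp
  simp_rw [this]
  linarith

end

open Classical in
/-- One-shot wiretap code. -/
lemma oneshot {K X Y Z : Type*} [Fintype K] [DecidableEq K] [Nonempty K] [Fintype X] [Fintype Y]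
    [Fintype Z] {P : X → ℝ} (hP : IsProbDist P) {V : X → Y → ℝ} (hV : IsChannel V)
    {W : X → Z → ℝ} (hW : IsChannel W) {L : ℕ} (hL : 0 < L) {γ₁ γ₂ : ℝ} (hγ₁ : 0 < γ₁)
    (hγ₂ : 0 < γ₂) {q : Y → ℝ} (hq : ∀ y, q y = ∑ x, P x * V x y)
    {r : Z → ℝ} (hr : ∀ z, r z = ∑ x, P x * W x z) :
    ∃ (c : K → Fin L → X) (fB : Y → K),
      (Fintype.card K : ℝ)⁻¹ * ∑ k, (L : ℝ)⁻¹ * ∑ l, ∑ y, (if fB y = k then 0 else V (c k l) y)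
        + ∑ k, ∑ z, |(L : ℝ)⁻¹ * ∑ l, W (c k l) z - r z|
      ≤ (∑ x, ∑ y, if V x y ≤ γ₁ * q y then P x * V x y else 0)
        + Fintype.card K * L / γ₁
        + Fintype.card K * (2 * (∑ x, ∑ z, if γ₂ * r z < W x z then P x * W x z else 0)
          + Real.sqrt (γ₂ / L)) := by
  have hL' : (L : ℝ) ≠ 0 := by positivity
  have hK' : (Fintype.card K : ℝ) ≠ 0 := by simp
  have hq0 : ∀ z, 0 ≤ q z := fun z => by
    rw [hq]; exact Finset.sum_nonneg fun x _ => mul_nonneg (hP.1 x) (hV.1 x z)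
  set d : (K × Fin L → X) → Y → K := fun c y =>
    if h : ∃ i : K × Fin L, γ₁ * q y < V (c i) y then h.choose.1 else Classical.arbitrary K with hd
  set err : K × Fin L → (K × Fin L → X) → ℝ := fun i c =>
    ∑ y, (if d c y = i.1 then 0 else V (c i) y) with herr
  set E0 := ∑ x, ∑ y, (if V x y ≤ γ₁ * q y then P x * V x y else 0) with hE0
  have herrb : ∀ i c, err i c ≤ ∑ y, ((if V (c i) y ≤ γ₁ * q y then V (c i) y else 0) +
      ∑ j ∈ Finset.univ.erase i, V (c i) y * (if γ₁ * q y < V (c j) y then 1 else 0)) := by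
    intro i c
    refine Finset.sum_le_sum fun y _ => ?_
    have hnn : ∀ j, 0 ≤ V (c i) y * (if γ₁ * q y < V (c j) y then (1 : ℝ) else 0) := fun j =>
      mul_nonneg (hV.1 _ _) (by split_ifs <;> norm_num)
    have hsn : 0 ≤ ∑ j ∈ Finset.univ.erase i,
        V (c i) y * (if γ₁ * q y < V (c j) y then (1 : ℝ) else 0) :=
      Finset.sum_nonneg fun j _ => hnn j
    by_cases h1 : d c y = i.1
    · rw [if_pos h1]
      refine add_nonneg ?_ hsn
      split_ifs
      exacts [hV.1 _ _, le_rfl]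
    · rw [if_neg h1]
      by_cases h2 : V (c i) y ≤ γ₁ * q y
      · rw [if_pos h2]; linarith
      · rw [if_neg h2, zero_add]
        have hex : ∃ i : K × Fin L, γ₁ * q y < V (c i) y := ⟨i, not_le.1 h2⟩
        have hdc : d c y = hex.choose.1 := by simp only [hd]; rw [dif_pos hex]
        have hne : hex.choose ≠ i := fun h => h1 (by rw [hdc, h])
        have := Finset.single_le_sum (s := Finset.univ.erase i)
          (f := fun j => V (c i) y * (if γ₁ * q y < V (c j) y then (1 : ℝ) else 0))
          (fun j _ => hnn j) (Finset.mem_erase.2 ⟨hne, Finset.mem_univ _⟩)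
        refine le_trans ?_ this
        rw [if_pos hex.choose_spec, mul_one]
  have hEerr : ∀ i, ex P (err i) ≤ E0 + Fintype.card K * L / γ₁ := by
    intro i
    refine (ex_mono hP (herrb i)).trans ?_
    rw [ex_sum]
    simp_rw [ex_add, ex_sum]
    rw [Finset.sum_add_distrib]
    refine add_le_add (le_of_eq ?_) ?_
    · have hone : ∀ y, ex P (fun c : K × Fin L → X =>
          if V (c i) y ≤ γ₁ * q y then V (c i) y else 0) =
          ∑ x, P x * (if V x y ≤ γ₁ * q y then V x y else 0) := fun y =>
        ex_one hP (fun x => if V x y ≤ γ₁ * q y then V x y else 0) i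
      simp_rw [hone]
      rw [Finset.sum_comm, hE0]
      refine Finset.sum_congr rfl fun x _ => Finset.sum_congr rfl fun y _ => ?_
      split_ifs <;> simp
    · rw [Finset.sum_comm]
      have hj : ∀ j ∈ Finset.univ.erase i, ∑ y, ex P (fun c : K × Fin L → X =>
          V (c i) y * (if γ₁ * q y < V (c j) y then (1 : ℝ) else 0)) ≤ 1 / γ₁ := by
        intro j hj
        have hij : i ≠ j := (Finset.mem_erase.1 hj).1.symm
        have hy : ∀ y, ex P (fun c : K × Fin L → X =>
            V (c i) y * (if γ₁ * q y < V (c j) y then (1 : ℝ) else 0)) ≤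
            ∑ x, P x * V x y / γ₁ := by
          intro y
          rw [ex_two hP (fun x => V x y) (fun x => if γ₁ * q y < V x y then (1 : ℝ) else 0) hij,
            ← hq, Finset.mul_sum]
          refine Finset.sum_le_sum fun x _ => ?_
          split_ifs with h
          · rw [le_div_iff₀ hγ₁]
            calc q y * (P x * 1) * γ₁ = P x * (γ₁ * q y) := by ring
              _ ≤ P x * V x y := mul_le_mul_of_nonneg_left h.le (hP.1 x)
          · have := mul_nonneg (hP.1 x) (hV.1 x y)
            simp only [mul_zero]
            positivity
        refine (Finset.sum_le_sum fun y _ => hy y).trans (le_of_eq ?_)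
        rw [Finset.sum_comm]
        simp_rw [← Finset.sum_div, ← Finset.mul_sum, hV.2, mul_one, hP.2]
      refine (Finset.sum_le_sum hj).trans ?_
      rw [Finset.sum_const, nsmul_eq_mul, mul_one_div]
      have : ((Finset.univ.erase i : Finset (K × Fin L)).card : ℝ) ≤ Fintype.card K * L := by
        have := Finset.card_le_univ (Finset.univ.erase i : Finset (K × Fin L))
        rw [Fintype.card_prod, Fintype.card_fin] at this
        exact_mod_cast this
      gcongr
  have hex : ex P (fun c : K × Fin L → X =>
      (Fintype.card K : ℝ)⁻¹ * ∑ k, (L : ℝ)⁻¹ * ∑ l, err (k, l) c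
        + ∑ k, ∑ z, |(L : ℝ)⁻¹ * ∑ l, W (c (k, l)) z - r z|) ≤ E0
        + Fintype.card K * L / γ₁
        + Fintype.card K * (2 * (∑ x, ∑ z, if γ₂ * r z < W x z then P x * W x z else 0)
          + Real.sqrt (γ₂ / L)) := by
    rw [ex_add]
    refine add_le_add ?_ ?_
    · rw [ex_smul, ex_sum]
      simp_rw [ex_smul, ex_sum]
      calc (Fintype.card K : ℝ)⁻¹ * ∑ k : K, (L : ℝ)⁻¹ * ∑ l : Fin L, ex P (err (k, l))
          ≤ (Fintype.card K : ℝ)⁻¹ * ∑ k : K, (L : ℝ)⁻¹ * ∑ l : Fin L,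
            (E0 + Fintype.card K * L / γ₁) := by
              gcongr with k _ l _
              exact hEerr (k, l)
        _ = _ := by
              simp only [Finset.sum_const, Finset.card_univ, Fintype.card_fin, nsmul_eq_mul]
              rw [inv_mul_cancel_left₀ hL', inv_mul_cancel_left₀ hK']
    · rw [ex_sum]
      refine (Finset.sum_le_sum fun k _ => soft_covering hP hW hL (fun l : Fin L => (k, l))
        (fun a b h => by simpa using h) hγ₂ hr).trans (le_of_eq ?_)
      rw [Finset.sum_const, Finset.card_univ, nsmul_eq_mul]
  obtain ⟨c, hc⟩ := ex_exists hP hex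
  exact ⟨fun k l => c (k, l), d c, hc⟩

/-! ### Chernoff bounds -/

lemma exp_moment_lt_one {S : Type*} [Fintype S] {p : S → ℝ} (hp : IsProbDist p) {g : S → ℝ}
    (hg : ∑ s, p s * g s < 0) : ∃ t : ℝ, 0 < t ∧ ∑ s, p s * Real.exp (t * g s) < 1 := by
  have hd : HasDerivAt (fun t : ℝ => ∑ s, p s * Real.exp (t * g s)) (∑ s, p s * g s) 0 := by
    refine HasDerivAt.fun_sum fun s _ => ?_
    have h1 : HasDerivAt (fun t : ℝ => t * g s) (g s) 0 := by
      simpa using (hasDerivAt_id (0 : ℝ)).mul_const (g s)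
    have h2 := (h1.exp).const_mul (p s)
    simpa using h2
  have h3 := hd.tendsto_slope_zero_right
  have h4 := h3.eventually (eventually_lt_nhds hg)
  obtain ⟨t, ht, ht0⟩ := (h4.and self_mem_nhdsWithin).exists
  refine ⟨t, ht0, ?_⟩
  have ht0' : (0 : ℝ) < t := ht0
  simp only [zero_add, zero_mul, Real.exp_zero, mul_one, hp.2, smul_eq_mul] at ht
  by_contra! h
  have : 0 ≤ t⁻¹ * (∑ s, p s * Real.exp (t * g s) - 1) :=
    mul_nonneg (by positivity) (by linarith)
  linarith

open Classical in
lemma chernoff {S : Type*} [Fintype S] {p : S → ℝ} (hp : IsProbDist p) {g : S → ℝ}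
    (hg : ∑ s, p s * g s < 0) : ∃ ρ : ℝ, 0 ≤ ρ ∧ ρ < 1 ∧ ∀ n : ℕ,
      ∑ s : Fin n → S, (if 0 ≤ ∑ i, g (s i) then ∏ i, p (s i) else 0) ≤ ρ ^ n := by
  obtain ⟨t, ht, h⟩ := exp_moment_lt_one hp hg
  refine ⟨_, Finset.sum_nonneg fun s _ => mul_nonneg (hp.1 s) (Real.exp_pos _).le, h, fun n => ?_⟩
  have : (∑ s, p s * Real.exp (t * g s)) ^ n =
      ∑ s : Fin n → S, ∏ i, (p (s i) * Real.exp (t * g (s i))) := by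
    rw [sum_pi_prod (fun _ s => p s * Real.exp (t * g s))]
    simp
  rw [this]
  refine Finset.sum_le_sum fun s _ => ?_
  have h0 : 0 ≤ ∏ i, p (s i) := Finset.prod_nonneg fun _ _ => hp.1 _
  rw [Finset.prod_mul_distrib, ← Real.exp_sum, ← Finset.mul_sum]
  split_ifs with h1
  · exact le_mul_of_one_le_right h0 (Real.one_le_exp (mul_nonneg ht.le h1))
  · exact mul_nonneg h0 (Real.exp_pos _).le

/-- Mutual information in nats. -/
def natMI {A B : Type*} [Fintype A] [Fintype B] (P : A → ℝ) (V : A → B → ℝ) : ℝ :=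
  ∑ a, ∑ b, P a * V a b * (Real.log (V a b) - Real.log (∑ a', P a' * V a' b))

lemma chanMI_eq {A B : Type*} [Fintype A] [Fintype B] {P : A → ℝ}
    {V : A → B → ℝ} (hV : IsChannel V) : chanMI P V = natMI P V / Real.log 2 := by
  unfold chanMI miJoint entropy
  rw [← add_div, ← sub_div]
  congr 1
  have h1 : ∀ a, ∑ b, P a * V a b = P a := fun a => by rw [← Finset.mul_sum, hV.2, mul_one]
  simp_rw [h1]
  rw [Fintype.sum_prod_type]
  unfold natMI
  have h2 : ∑ a, Real.negMulLog (P a) = ∑ a, ∑ b, -(P a * V a b * Real.log (P a)) := by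
    refine Finset.sum_congr rfl fun a _ => ?_
    rw [Finset.sum_neg_distrib, ← Finset.sum_mul, h1, Real.negMulLog, neg_mul]
  have h3 : ∑ b, Real.negMulLog (∑ a, P a * V a b) =
      ∑ a, ∑ b, -(P a * V a b * Real.log (∑ a', P a' * V a' b)) := by
    rw [Finset.sum_comm]
    refine Finset.sum_congr rfl fun b _ => ?_
    rw [Finset.sum_neg_distrib, ← Finset.sum_mul, Real.negMulLog, neg_mul]
  rw [h2, h3, ← Finset.sum_add_distrib, ← Finset.sum_sub_distrib]
  refine Finset.sum_congr rfl fun a _ => ?_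
  rw [← Finset.sum_add_distrib, ← Finset.sum_sub_distrib]
  refine Finset.sum_congr rfl fun b _ => ?_
  by_cases hp : P a = 0
  · simp [hp]
  by_cases hv : V a b = 0
  · simp [hv]
  rw [Real.negMulLog, Real.log_mul hp hv]
  ring

lemma out_pos {A B : Type*} [Fintype A] [Fintype B] {P : A → ℝ} (hP : IsProbDist P)
    {V : A → B → ℝ} (hV : IsChannel V) {a : A} {b : B} (h : P a * V a b ≠ 0) :
    0 < V a b ∧ 0 < ∑ a', P a' * V a' b := by
  refine ⟨lt_of_le_of_ne (hV.1 a b) fun h' => h (by rw [← h', mul_zero]), ?_⟩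
  have h1 : 0 < P a * V a b := lt_of_le_of_ne (mul_nonneg (hP.1 a) (hV.1 a b)) (Ne.symm h)
  exact lt_of_lt_of_le h1 (Finset.single_le_sum (f := fun a' => P a' * V a' b)
    (fun a' _ => mul_nonneg (hP.1 a') (hV.1 a' b)) (Finset.mem_univ a))

lemma out_prob {A B : Type*} [Fintype A] [Fintype B] {P : A → ℝ} (hP : IsProbDist P)
    {V : A → B → ℝ} (hV : IsChannel V) : ∑ a, ∑ b, P a * V a b = 1 := by
  simp_rw [← Finset.mul_sum, hV.2, mul_one]
  exact hP.2

lemma natMI_nonneg {A B : Type*} [Fintype A] [Fintype B] {P : A → ℝ} (hP : IsProbDist P)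
    {V : A → B → ℝ} (hV : IsChannel V) : 0 ≤ natMI P V := by
  have h1 : ∑ a, ∑ b, (P a * V a b - P a * ∑ a', P a' * V a' b) ≤ natMI P V := by
    refine Finset.sum_le_sum fun a _ => Finset.sum_le_sum fun b _ => ?_
    by_cases h : P a * V a b = 0
    · rw [h, zero_mul, zero_sub, neg_nonpos]
      exact mul_nonneg (hP.1 a) (Finset.sum_nonneg fun a' _ => mul_nonneg (hP.1 a') (hV.1 a' b))
    · obtain ⟨hv, hq⟩ := out_pos hP hV h
      have hl := Real.log_le_sub_one_of_pos (div_pos hq hv)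
      rw [Real.log_div hq.ne' hv.ne'] at hl
      calc P a * V a b - P a * ∑ a', P a' * V a' b
          = P a * V a b * (1 - (∑ a', P a' * V a' b) / V a b) := by field_simp
        _ ≤ _ := mul_le_mul_of_nonneg_left (by linarith) (mul_nonneg (hP.1 a) (hV.1 a b))
  refine le_trans (le_of_eq ?_) h1
  simp_rw [Finset.sum_sub_distrib, ← Finset.mul_sum]
  rw [← Finset.sum_mul, hP.2, one_mul, Finset.sum_comm (f := fun b a' => P a' * V a' b),
    out_prob hP hV]
  simp_rw [hV.2, mul_one, hP.2]
  simp

lemma joint_prob {A B : Type*} [Fintype A] [Fintype B] {P : A → ℝ} (hP : IsProbDist P)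
    {V : A → B → ℝ} (hV : IsChannel V) :
    IsProbDist (fun s : A × B => P s.1 * V s.1 s.2) :=
  ⟨fun s => mul_nonneg (hP.1 _) (hV.1 _ _), by rw [Fintype.sum_prod_type]; exact out_prob hP hV⟩

lemma sum_pairs {A B : Type*} [Fintype A] [Fintype B] {n : ℕ}
    (G : (Fin n → A) → (Fin n → B) → ℝ) :
    ∑ x, ∑ y, G x y = ∑ s : Fin n → A × B, G (fun i => (s i).1) (fun i => (s i).2) := by
  rw [← Fintype.sum_prod_type']
  exact (Fintype.sum_equiv (Equiv.arrowProdEquivProdArrow (Fin n) (fun _ => A) (fun _ => B)) _ _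
    fun s => rfl).symm

lemma log_nfold {A B : Type*} [Fintype A] [Fintype B] {P : A → ℝ} (hP : IsProbDist P)
    {V : A → B → ℝ} (hV : IsChannel V) (r : ℝ) {n : ℕ} {s : Fin n → A × B}
    (h : ∏ i, (P (s i).1 * V (s i).1 (s i).2) ≠ 0) :
    0 < ∏ i, V (s i).1 (s i).2 ∧
    0 < Real.exp (n * r) * ∏ i, ∑ a', P a' * V a' (s i).2 ∧
    Real.log (∏ i, V (s i).1 (s i).2) -
      Real.log (Real.exp (n * r) * ∏ i, ∑ a', P a' * V a' (s i).2) =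
    ∑ i, (Real.log (V (s i).1 (s i).2) - Real.log (∑ a', P a' * V a' (s i).2) - r) := by
  have h1 : ∀ i, _ := fun i => out_pos hP hV (Finset.prod_ne_zero_iff.1 h i (Finset.mem_univ i))
  have hq : 0 < ∏ i, ∑ a', P a' * V a' (s i).2 := Finset.prod_pos fun i _ => (h1 i).2
  refine ⟨Finset.prod_pos fun i _ => (h1 i).1, mul_pos (Real.exp_pos _) hq, ?_⟩
  rw [Real.log_mul (Real.exp_pos _).ne' hq.ne', Real.log_exp,
    Real.log_prod (fun i _ => (h1 i).1.ne'), Real.log_prod (fun i _ => (h1 i).2.ne'),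
    Finset.sum_sub_distrib, Finset.sum_sub_distrib]
  simp
  ring

open Classical in
lemma tail_low {A B : Type*} [Fintype A] [Fintype B] {P : A → ℝ} (hP : IsProbDist P)
    {V : A → B → ℝ} (hV : IsChannel V) {r : ℝ} (hr : r < natMI P V) :
    ∃ ρ : ℝ, 0 ≤ ρ ∧ ρ < 1 ∧ ∀ n : ℕ, ∑ x : Fin n → A, ∑ y : Fin n → B,
      (if nfold n V x y ≤ Real.exp (n * r) * ∏ i, ∑ a', P a' * V a' (y i)
        then (∏ i, P (x i)) * nfold n V x y else 0) ≤ ρ ^ n := by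
  obtain ⟨ρ, h0, h1, h2⟩ := chernoff (joint_prob hP hV)
    (g := fun s => -(Real.log (V s.1 s.2) - Real.log (∑ a', P a' * V a' s.2) - r)) (by
      simp_rw [mul_neg, mul_sub _ (_ - _) r]
      rw [Finset.sum_neg_distrib, Finset.sum_sub_distrib, ← Finset.sum_mul,
        (joint_prob hP hV).2, Fintype.sum_prod_type]
      unfold natMI at hr
      linarith)
  refine ⟨ρ, h0, h1, fun n => le_trans ?_ (h2 n)⟩
  rw [sum_pairs]
  refine Finset.sum_le_sum fun s _ => ?_
  unfold nfold
  rw [← Finset.prod_mul_distrib]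
  by_cases h : ∏ i, (P (s i).1 * V (s i).1 (s i).2) = 0
  · simp [h]
  · obtain ⟨hv, hq, hl⟩ := log_nfold hP hV r h
    have hn : 0 ≤ ∏ i, (P (s i).1 * V (s i).1 (s i).2) :=
      Finset.prod_nonneg fun i _ => mul_nonneg (hP.1 _) (hV.1 _ _)
    split_ifs with h3 h4
    · exact le_rfl
    · exfalso; apply h4
      rw [Finset.sum_neg_distrib, ← hl]
      linarith [Real.log_le_log hv h3]
    · exact hn
    · exact le_rfl

open Classical in
lemma tail_high {A B : Type*} [Fintype A] [Fintype B] {P : A → ℝ} (hP : IsProbDist P)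
    {V : A → B → ℝ} (hV : IsChannel V) {r : ℝ} (hr : natMI P V < r) :
    ∃ ρ : ℝ, 0 ≤ ρ ∧ ρ < 1 ∧ ∀ n : ℕ, ∑ x : Fin n → A, ∑ y : Fin n → B,
      (if Real.exp (n * r) * ∏ i, ∑ a', P a' * V a' (y i) < nfold n V x y
        then (∏ i, P (x i)) * nfold n V x y else 0) ≤ ρ ^ n := by
  obtain ⟨ρ, h0, h1, h2⟩ := chernoff (joint_prob hP hV)
    (g := fun s => (Real.log (V s.1 s.2) - Real.log (∑ a', P a' * V a' s.2) - r)) (by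
      simp_rw [mul_sub _ (_ - _) r]
      rw [Finset.sum_sub_distrib, ← Finset.sum_mul,
        (joint_prob hP hV).2, Fintype.sum_prod_type]
      unfold natMI at hr
      linarith)
  refine ⟨ρ, h0, h1, fun n => le_trans ?_ (h2 n)⟩
  rw [sum_pairs]
  refine Finset.sum_le_sum fun s _ => ?_
  unfold nfold
  rw [← Finset.prod_mul_distrib]
  by_cases h : ∏ i, (P (s i).1 * V (s i).1 (s i).2) = 0
  · simp [h]
  · obtain ⟨hv, hq, hl⟩ := log_nfold hP hV r h
    have hn : 0 ≤ ∏ i, (P (s i).1 * V (s i).1 (s i).2) :=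
      Finset.prod_nonneg fun i _ => mul_nonneg (hP.1 _) (hV.1 _ _)
    split_ifs with h3 h4
    · exact le_rfl
    · exfalso; apply h4
      rw [← hl]
      linarith [Real.log_le_log hq h3.le]
    · exact hn
    · exact le_rfl

lemma nfold_channel {A B : Type*} [Fintype A] [Fintype B] {V : A → B → ℝ} (hV : IsChannel V)
    (n : ℕ) : IsChannel (nfold n V) := by
  refine ⟨fun a b => Finset.prod_nonneg fun i _ => hV.1 _ _, fun a => ?_⟩
  unfold nfold
  rw [sum_pi_prod (fun i b => V (a i) b)]
  simp [hV.2]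

lemma prod_dist {A : Type*} [Fintype A] {P : A → ℝ} (hP : IsProbDist P) (n : ℕ) :
    IsProbDist (fun x : Fin n → A => ∏ i, P (x i)) :=
  ⟨fun x => wt_nonneg hP x, wt_sum hP⟩

lemma nfold_out {A B : Type*} [Fintype A] [Fintype B] (P : A → ℝ) (V : A → B → ℝ)
    (n : ℕ) (y : Fin n → B) :
    ∏ i, ∑ a', P a' * V a' (y i) = ∑ x : Fin n → A, (∏ i, P (x i)) * nfold n V x y := by
  unfold nfold
  simp_rw [← Finset.prod_mul_distrib]
  rw [sum_pi_prod (fun i a => P a * V a (y i))]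

/-! ### Continuity of mutual information at product distributions -/

lemma mi_small (K : Type*) [Fintype K] [Nonempty K] {ε : ℝ} (hε : 0 < ε) :
    ∃ δ : ℝ, 0 < δ ∧ ∀ (p : K → K → ℝ) (q : K → ℝ), IsChannel p →
      (∀ k k', |p k k' - q k'| ≤ δ) →
      miJoint (fun k k' => (Fintype.card K : ℝ)⁻¹ * p k k') ≤ ε := by
  have hK : (0 : ℝ) < Fintype.card K := by exact_mod_cast Fintype.card_pos
  have hlog : 0 < Real.log 2 := Real.log_pos (by norm_num)
  have huc := isCompact_Icc.uniformContinuousOn_of_continuous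
    (Real.continuous_negMulLog.continuousOn (s := Set.Icc (0 : ℝ) 1))
  obtain ⟨η, hη, hu⟩ := Metric.uniformContinuousOn_iff.1 huc (ε * Real.log 2 / Fintype.card K)
    (by positivity)
  refine ⟨η / 3, by positivity, fun p q hp hpq => ?_⟩
  set N : ℝ := (Fintype.card K : ℝ) with hN
  have hp1 : ∀ k k', p k k' ∈ Set.Icc (0 : ℝ) 1 := fun k k' => ⟨hp.1 k k', by
    rw [← hp.2 k]
    exact Finset.single_le_sum (fun j _ => hp.1 k j) (Finset.mem_univ k')⟩
  set m : K → ℝ := fun k' => ∑ k, N⁻¹ * p k k' with hm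
  have hN1 : ∑ _k : K, N⁻¹ = 1 := by
    rw [Finset.sum_const, Finset.card_univ, nsmul_eq_mul, ← hN, mul_inv_cancel₀ hK.ne']
  have hm1 : ∀ k', m k' ∈ Set.Icc (0 : ℝ) 1 := fun k' =>
    ⟨Finset.sum_nonneg fun k _ => mul_nonneg (by positivity) (hp.1 k k'), by
      calc m k' ≤ ∑ _k : K, N⁻¹ := Finset.sum_le_sum fun k _ =>
            mul_le_of_le_one_right (by positivity) (hp1 k k').2
        _ = 1 := hN1⟩
  have hmq : ∀ k', |m k' - q k'| ≤ η / 3 := by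
    intro k'
    have : m k' - q k' = ∑ k, N⁻¹ * (p k k' - q k') := by
      simp_rw [mul_sub]
      rw [Finset.sum_sub_distrib, ← Finset.sum_mul, hN1, one_mul]
    rw [this]
    refine (Finset.abs_sum_le_sum_abs _ _).trans ?_
    calc ∑ k, |N⁻¹ * (p k k' - q k')| ≤ ∑ _k : K, N⁻¹ * (η / 3) := by
          refine Finset.sum_le_sum fun k _ => ?_
          rw [abs_mul, abs_of_pos (inv_pos.2 hK)]
          exact mul_le_mul_of_nonneg_left (hpq k k') (by positivity)
      _ = η / 3 := by rw [← Finset.sum_mul, hN1, one_mul]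
  have hd : ∀ k k', Real.negMulLog (m k') - Real.negMulLog (p k k') ≤ ε * Real.log 2 / N := by
    intro k k'
    have h1 : dist (m k') (p k k') < η := by
      rw [Real.dist_eq]
      have h2 := abs_sub_le (m k') (q k') (p k k')
      rw [abs_sub_comm (q k')] at h2
      linarith [hmq k', hpq k k']
    have h2 := hu _ (hm1 k') _ (hp1 k k') h1
    rw [Real.dist_eq] at h2
    exact (le_abs_self _).trans h2.le
  unfold miJoint entropy
  rw [← add_div, ← sub_div, div_le_iff₀ hlog]
  have hrow : ∀ k, ∑ k', N⁻¹ * p k k' = N⁻¹ := fun k => by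
    rw [← Finset.mul_sum, hp.2, mul_one]
  have hjoint : ∀ k, ∑ k', Real.negMulLog (N⁻¹ * p k k') =
      Real.negMulLog N⁻¹ + ∑ k', N⁻¹ * Real.negMulLog (p k k') := fun k => by
    simp_rw [Real.negMulLog_mul]
    rw [Finset.sum_add_distrib, ← Finset.sum_mul, hp.2, one_mul]
  simp_rw [hrow]
  rw [Fintype.sum_prod_type]
  simp_rw [hjoint]
  rw [Finset.sum_add_distrib]
  have hrw : ∑ k' : K, Real.negMulLog (∑ k, N⁻¹ * p k k') =
      ∑ k' : K, ∑ _k : K, N⁻¹ * Real.negMulLog (m k') := by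
    refine Finset.sum_congr rfl fun k' _ => ?_
    rw [← Finset.sum_mul, hN1, one_mul]
  rw [hrw, Finset.sum_comm (f := fun k k' => N⁻¹ * Real.negMulLog (p k k'))]
  have hfin : ∑ k' : K, ∑ k : K, N⁻¹ * (Real.negMulLog (m k') - Real.negMulLog (p k k')) ≤
      ∑ _k' : K, ∑ _k : K, N⁻¹ * (ε * Real.log 2 / N) :=
    Finset.sum_le_sum fun k' _ => Finset.sum_le_sum fun k _ =>
      mul_le_mul_of_nonneg_left (hd k k') (by positivity)
  have hcst : ∑ _k : K, N⁻¹ * (ε * Real.log 2 / N) = ε * Real.log 2 / N := by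
    rw [← Finset.sum_mul, hN1, one_mul]
  simp_rw [hcst, mul_sub, Finset.sum_sub_distrib] at hfin
  rw [Finset.sum_const, Finset.card_univ, nsmul_eq_mul, ← hN, mul_div_cancel₀ _ hK.ne'] at hfin
  linarith

/-- **Csiszár–Körner achievability (Theorem 1, sufficiency).**
If some input distribution `P` satisfies `I(P,V) - I(P,W) > 0`, then for all
`α, β ∈ (0,1)` and all sufficiently large `n` there is a random coder
`F : K → Aⁿ` and a decoder `f_B : Bⁿ → K` such that for every adversary decoder
`f_E : Eⁿ → K`: `Pr[K_A = K_B] ≥ α` and `I(K_A; K_E) ≤ 1 - β`. -/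
theorem csiszarKorner_achievability
    {K A B E : Type*} [Fintype K] [Fintype A] [Fintype B] [Fintype E]
    [DecidableEq K] [Nonempty K] [Nonempty A]
    (V : A → B → ℝ) (W : A → E → ℝ) (hV : IsChannel V) (hW : IsChannel W)
    (hgap : ∃ P : A → ℝ, IsProbDist P ∧ 0 < chanMI P V - chanMI P W) :
    ∀ α β : ℝ, α ∈ Set.Ioo (0 : ℝ) 1 → β ∈ Set.Ioo (0 : ℝ) 1 →
      ∃ N : ℕ, ∀ n, N ≤ n →
        ∃ (F : K → (Fin n → A) → ℝ) (fB : (Fin n → B) → K), IsChannel F ∧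
          ∀ fE : (Fin n → E) → K,
            α ≤ ∑ k, keyJoint F (nfold n V) fB k k ∧
            miJoint (keyJoint F (nfold n W) fE) ≤ 1 - β := by
  classical
  intro α β hα hβ
  obtain ⟨P, hP, hgap⟩ := hgap
  have hlog : 0 < Real.log 2 := Real.log_pos (by norm_num)
  rw [chanMI_eq hV, chanMI_eq hW, ← sub_div] at hgap
  have hgap' : natMI P W < natMI P V := by
    by_contra! h
    have := div_nonpos_of_nonpos_of_nonneg (sub_nonpos.2 h) hlog.le
    linarith
  obtain ⟨R, hR1, hR2⟩ := exists_between hgap'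
  obtain ⟨r₁, hr1, hr1'⟩ := exists_between hR2
  obtain ⟨r₂, hr2, hr2'⟩ := exists_between hR1
  have hR0 : 0 ≤ R := (natMI_nonneg hP hW).trans hR1.le
  obtain ⟨ρ₁, hρ10, hρ11, htl⟩ := tail_low hP hV hr1'
  obtain ⟨ρ₂, hρ20, hρ21, hth⟩ := tail_high hP hW hr2
  obtain ⟨δ, hδ, hmi⟩ := mi_small K (ε := 1 - β) (by linarith [hβ.2])
  have hKpos : (0 : ℝ) < Fintype.card K := by exact_mod_cast Fintype.card_pos
  -- the total error tends to zero
  have hlim : Filter.Tendsto (fun n : ℕ => ρ₁ ^ n + Fintype.card K * (2 * Real.exp (R - r₁) ^ n)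
      + Fintype.card K * (2 * ρ₂ ^ n + Real.exp ((r₂ - R) / 2) ^ n)) Filter.atTop (nhds 0) := by
    have t1 := tendsto_pow_atTop_nhds_zero_of_lt_one hρ10 hρ11
    have t2 := tendsto_pow_atTop_nhds_zero_of_lt_one hρ20 hρ21
    have t3 := tendsto_pow_atTop_nhds_zero_of_lt_one (Real.exp_pos (R - r₁)).le
      (Real.exp_lt_one_iff.2 (by linarith))
    have t4 := tendsto_pow_atTop_nhds_zero_of_lt_one (Real.exp_pos ((r₂ - R) / 2)).le
      (Real.exp_lt_one_iff.2 (by linarith))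
    have := (t1.add ((t3.const_mul 2).const_mul (Fintype.card K : ℝ))).add
      (((t2.const_mul 2).add t4).const_mul (Fintype.card K : ℝ))
    simpa using this
  have hmin : 0 < min δ (1 - α) := lt_min hδ (by linarith [hα.2])
  obtain ⟨N, hN⟩ := Filter.eventually_atTop.1 (hlim.eventually (eventually_lt_nhds hmin))
  refine ⟨N, fun n hn => ?_⟩
  have hbound := hN n hn
  set L : ℕ := ⌈Real.exp (n * R)⌉₊ with hLdef
  have hL : 0 < L := Nat.ceil_pos.2 (Real.exp_pos _)
  have hLlow : Real.exp (n * R) ≤ L := Nat.le_ceil _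
  have hLup : (L : ℝ) ≤ 2 * Real.exp (n * R) := by
    have h1 := Nat.ceil_lt_add_one (Real.exp_pos (n * R)).le
    have h2 : 1 ≤ Real.exp (n * R) := Real.one_le_exp (by positivity)
    linarith
  have hL0 : (0 : ℝ) < L := by exact_mod_cast hL
  obtain ⟨c, fB, hc⟩ := oneshot (K := K) (prod_dist hP n) (nfold_channel hV n)
    (nfold_channel hW n) hL (Real.exp_pos (n * r₁)) (Real.exp_pos (n * r₂))
    (nfold_out P V n) (nfold_out P W n)
  set T1 := (Fintype.card K : ℝ)⁻¹ * ∑ k, (L : ℝ)⁻¹ * ∑ l, ∑ y,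
    (if fB y = k then 0 else nfold n V (c k l) y) with hT1
  set r : (Fin n → E) → ℝ := fun z => ∏ i, ∑ a', P a' * W a' (z i) with hr
  set T2 := ∑ k, ∑ z, |(L : ℝ)⁻¹ * ∑ l, nfold n W (c k l) z - r z| with hT2
  have hVn := nfold_channel hV n
  have hWn := nfold_channel hW n
  have hT10 : 0 ≤ T1 := by
    refine mul_nonneg (by positivity) (Finset.sum_nonneg fun k _ => mul_nonneg (by positivity)
      (Finset.sum_nonneg fun l _ => Finset.sum_nonneg fun y _ => ?_))
    split_ifs
    exacts [le_rfl, hVn.1 _ _]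
  have hT20 : 0 ≤ T2 :=
    Finset.sum_nonneg fun k _ => Finset.sum_nonneg fun z _ => abs_nonneg _
  have htot : T1 + T2 < min δ (1 - α) := by
    refine lt_of_le_of_lt (hc.trans ?_) hbound
    have e1 : Fintype.card K * (L : ℝ) / Real.exp (n * r₁) ≤
        Fintype.card K * (2 * Real.exp (R - r₁) ^ n) := by
      rw [mul_div_assoc]
      refine mul_le_mul_of_nonneg_left ?_ hKpos.le
      rw [← Real.exp_nat_mul, mul_sub, Real.exp_sub, ← mul_div_assoc]
      exact div_le_div_of_nonneg_right hLup (Real.exp_pos _).le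
    have e2 : Real.sqrt (Real.exp (n * r₂) / L) ≤ Real.exp ((r₂ - R) / 2) ^ n := by
      apply Real.sqrt_le_iff.2
      refine ⟨by positivity, ?_⟩
      rw [← Real.exp_nat_mul, ← Real.exp_nat_mul]
      calc Real.exp (n * r₂) / L ≤ Real.exp (n * r₂) / Real.exp (n * R) :=
            div_le_div_of_nonneg_left (Real.exp_pos _).le (Real.exp_pos _) hLlow
        _ = _ := by rw [← Real.exp_sub]; congr 1; push_cast; ring
    refine add_le_add (add_le_add (htl n) e1) (mul_le_mul_of_nonneg_left ?_ hKpos.le)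
    exact add_le_add (mul_le_mul_of_nonneg_left (hth n) (by norm_num)) e2
  have hT1' : T1 ≤ 1 - α := by linarith [min_le_right δ (1 - α)]
  have hT2' : T2 ≤ δ := by linarith [min_le_left δ (1 - α)]
  -- the random coder
  set F : K → (Fin n → A) → ℝ := fun k a => (L : ℝ)⁻¹ * ∑ l, if c k l = a then 1 else 0 with hF
  have hFsum : ∀ (k : K) (g : (Fin n → A) → ℝ),
      ∑ a, F k a * g a = (L : ℝ)⁻¹ * ∑ l, g (c k l) := by
    intro k g
    simp_rw [hF, mul_assoc, Finset.sum_mul]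
    rw [← Finset.mul_sum, Finset.sum_comm]
    simp
  have hFc : IsChannel F := by
    refine ⟨fun k a => mul_nonneg (by positivity) (Finset.sum_nonneg fun l _ => ?_), fun k => ?_⟩
    · split_ifs <;> norm_num
    · have := hFsum k (fun _ => 1)
      simp only [mul_one] at this
      rw [this]
      simp [hL0.ne']
  refine ⟨F, fB, hFc, fun fE => ⟨?_, ?_⟩⟩
  · have hs : ∑ k, keyJoint F (nfold n V) fB k k = 1 - T1 := by
      have h1 : ∀ k, (L : ℝ)⁻¹ * ∑ l, ∑ b, (if fB b = k then nfold n V (c k l) b else 0) =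
          1 - (L : ℝ)⁻¹ * ∑ l, ∑ y, (if fB y = k then 0 else nfold n V (c k l) y) := by
        intro k
        rw [eq_sub_iff_add_eq, ← mul_add, ← Finset.sum_add_distrib]
        have : ∀ l, ∑ b, (if fB b = k then nfold n V (c k l) b else 0) +
            ∑ y, (if fB y = k then 0 else nfold n V (c k l) y) = 1 := by
          intro l
          rw [← Finset.sum_add_distrib, ← hVn.2 (c k l)]
          refine Finset.sum_congr rfl fun b _ => ?_
          split_ifs <;> simp
        simp_rw [this]
        simp [hL0.ne']
      unfold keyJoint
      simp_rw [hFsum _ (fun a => ∑ b, if fB b = _ then nfold n V a b else 0)]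
      rw [← Finset.mul_sum]
      simp_rw [h1]
      rw [Finset.sum_sub_distrib, mul_sub, hT1]
      congr 1
      · simp [hKpos.ne']
    rw [hs]
    linarith
  · set p : K → K → ℝ := fun k k' =>
      ∑ a, F k a * ∑ b, if fE b = k' then nfold n W a b else 0 with hp
    have hpch : IsChannel p := by
      refine ⟨fun k k' => Finset.sum_nonneg fun a _ => mul_nonneg (hFc.1 k a)
        (Finset.sum_nonneg fun b _ => ?_), fun k => ?_⟩
      · split_ifs
        exacts [hWn.1 _ _, le_rfl]
      · simp only [hp]
        rw [Finset.sum_comm]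
        simp_rw [← Finset.mul_sum]
        have : ∀ a, ∑ k', ∑ b, (if fE b = k' then nfold n W a b else 0) = 1 := by
          intro a
          rw [Finset.sum_comm]
          simp [hWn.2]
        simp_rw [this, mul_one]
        exact hFc.2 k
    refine hmi p (fun k' => ∑ b, if fE b = k' then r b else 0) hpch fun k k' => ?_
    refine le_trans ?_ hT2'
    have h1 : p k k' - ∑ b, (if fE b = k' then r b else 0) =
        ∑ b, if fE b = k' then ((L : ℝ)⁻¹ * ∑ l, nfold n W (c k l) b - r b) else 0 := by
      simp only [hp]
      rw [hFsum k (fun a => ∑ b, if fE b = k' then nfold n W a b else 0), Finset.sum_comm,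
        Finset.mul_sum, ← Finset.sum_sub_distrib]
      refine Finset.sum_congr rfl fun b _ => ?_
      split_ifs <;> simp
    rw [h1]
    refine (Finset.abs_sum_le_sum_abs _ _).trans ?_
    refine le_trans (Finset.sum_le_sum fun b _ => ?_) (Finset.single_le_sum
      (f := fun k => ∑ z, |(L : ℝ)⁻¹ * ∑ l, nfold n W (c k l) z - r z|)
      (fun k _ => Finset.sum_nonneg fun z _ => abs_nonneg _) (Finset.mem_univ k))
    split_ifs
    · exact le_rfl
    · rw [abs_zero]; exact abs_nonneg _

end QKD
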